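/- Let f : ℝ × ℝ^N → ℝ satisfy Hypothesis 5. Then for every K ∈ ℕ, the bipolar (f_K)** of the truncated function f_K is jointly continuous on ℝ × B_K(0); furthermore, f** is a Borel function on ℝ × ℝ^N. -/

import Mathlib

open MeasureTheory Filter Metric Set Topology
open scoped RealInnerProductSpace ENNReal NNReal

/-- Euclidean space `ℝ^N`. -/
abbrev Euc (N : ℕ) := EuclideanSpace ℝ (Fin N)

/-- A bounded open set with Lipschitz boundary (interior direction condition at the
boundary, a standard property of bounded Lipschitz domains). -/
def IsLipschitzDomain {N : ℕ} (Ω : Set (Euc N)) : Prop :=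
  IsOpen Ω ∧ Bornology.IsBounded Ω ∧
    ∀ x ∈ frontier Ω, ∃ v : Euc N, ‖v‖ = 1 ∧ ∃ r > (0 : ℝ), ∃ ε > (0 : ℝ),
      ∀ y ∈ ball x r ∩ closure Ω, ∀ t ∈ Set.Ioo (0 : ℝ) ε, y + t • v ∈ Ω

/-- `u ∈ W^{1,∞}(Ω)`: `u` is (a representative of) a Lipschitz function on `Ω`
(equivalently, on its closure). -/
def MemW1inf {N : ℕ} (Ω : Set (Euc N)) (u : Euc N → ℝ) : Prop :=
  ∃ C : ℝ≥0, LipschitzOnWith C u (closure Ω)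

/-- `‖∇u‖_{L^∞(Ω)} < K`: the essential supremum of `‖∇u‖` on `Ω` is `< K`. -/
def GradSupLt {N : ℕ} (Ω : Set (Euc N)) (u : Euc N → ℝ) (K : ℝ) : Prop :=
  ∃ C : ℝ, C < K ∧ ∀ᵐ x ∂(volume.restrict Ω), ‖gradient u x‖ ≤ C

/-- Weak* convergence `v_n ⇀* u` in `W^{1,∞}(Ω)`: uniform convergence of the functions on
`Ω` together with weak* convergence of the gradients in `L^∞(Ω; ℝ^N)` (testing against
arbitrary `L¹` vector fields). -/
def WeakStarConvW1inf {N : ℕ} (Ω : Set (Euc N)) (v : ℕ → Euc N → ℝ) (u : Euc N → ℝ) : Prop :=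
  TendstoUniformlyOn v u atTop Ω ∧
    ∀ G : Euc N → Euc N, Integrable G (volume.restrict Ω) →
      Tendsto (fun n => ∫ x in Ω, ⟪gradient (v n) x, G x⟫) atTop
        (𝓝 (∫ x in Ω, ⟪gradient u x, G x⟫))

/-- The bipolar `g**` of a function `g` (restricted to the set `s`, i.e. `g = +∞` off `s`)
with respect to the variable `ξ`: the pointwise supremum of all affine minorants of `g` on
`s`, which is the largest convex lower semicontinuous function below `g` on `s`. -/
noncomputable def convexifyOn {N : ℕ} (g : Euc N → ℝ) (s : Set (Euc N)) (ξ : Euc N) : ℝ :=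
  sSup { r : ℝ | ∃ p : Euc N, ∃ c : ℝ, (∀ ζ ∈ s, ⟪p, ζ⟫ + c ≤ g ζ) ∧ r = ⟪p, ξ⟫ + c }


/-- Hypothesis 5 for an autonomous Lagrangian `f : ℝ × ℝ^N → ℝ`:
(i) `f` is Borel;
(ii) `f(u,ξ)` is continuous in `u` uniformly as `ξ` varies in each bounded set of `ℝ^N`;
(iii) `f(u,·)` is bounded on bounded sets of `ℝ^N` for every `u`. -/
def Hyp5 {N : ℕ} (f : ℝ → Euc N → ℝ) : Prop :=
  Measurable (fun q : ℝ × Euc N => f q.1 q.2) ∧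
  (∀ u₀ : ℝ, ∀ B : Set (Euc N), Bornology.IsBounded B → ∀ ε > (0 : ℝ), ∃ δ > (0 : ℝ),
      ∀ u : ℝ, |u - u₀| < δ → ∀ ξ ∈ B, |f u ξ - f u₀ ξ| < ε) ∧
  (∀ u : ℝ, ∀ B : Set (Euc N), Bornology.IsBounded B → ∃ M : ℝ, ∀ ξ ∈ B, |f u ξ| ≤ M)

/-- The bipolar `g**` with values in the extended reals, of a real-valued function `g`
truncated to `+∞` off the set `s`: the pointwise supremum of all affine minorants of `g`
on `s` (i.e. the biconjugate of the truncated function in the variable `ξ`). -/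
noncomputable def convexifyOnE {N : ℕ} (g : Euc N → ℝ) (s : Set (Euc N)) (ξ : Euc N) :
    EReal :=
  ⨆ (p : Euc N) (c : ℝ) (_ : ∀ ζ ∈ s, ⟪p, ζ⟫ + c ≤ g ζ), ((⟪p, ξ⟫ + c : ℝ) : EReal)

section BipolarContinuity

variable {N : ℕ} {g h : Euc N → ℝ} {s : Set (Euc N)} {ξ : Euc N}

lemma inner_add_le_convexifyOn (hξ : ξ ∈ s) {p : Euc N} {c : ℝ}
    (hpc : ∀ ζ ∈ s, ⟪p, ζ⟫ + c ≤ g ζ) : ⟪p, ξ⟫ + c ≤ convexifyOn g s ξ := by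
  refine le_csSup ⟨g ξ, ?_⟩ ⟨p, c, hpc, rfl⟩
  rintro _ ⟨p, c, hpc, rfl⟩
  exact hpc ξ hξ

lemma convexifyOn_le {M b : ℝ} (hM : ∀ ζ ∈ s, M ≤ g ζ)
    (hb : ∀ (p : Euc N) (c : ℝ), (∀ ζ ∈ s, ⟪p, ζ⟫ + c ≤ g ζ) → ⟪p, ξ⟫ + c ≤ b) :
    convexifyOn g s ξ ≤ b := by
  refine csSup_le ⟨⟪(0 : Euc N), ξ⟫ + M, 0, M, fun ζ hζ => ?_, rfl⟩ ?_
  · simpa using hM ζ hζ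
  · rintro _ ⟨p, c, hpc, rfl⟩
    exact hb p c hpc

lemma convexifyOnE_eq_coe {M : ℝ} (hM : ∀ ζ ∈ s, M ≤ g ζ) (hξ : ξ ∈ s) :
    convexifyOnE g s ξ = (convexifyOn g s ξ : EReal) := by
  have hle : ∀ (p : Euc N) (c : ℝ), (∀ ζ ∈ s, ⟪p, ζ⟫ + c ≤ g ζ) →
      ((⟪p, ξ⟫ + c : ℝ) : EReal) ≤ convexifyOnE g s ξ := fun p c hpc =>
    le_iSup_of_le p (le_iSup_of_le c (le_iSup_of_le hpc le_rfl))
  have hub : convexifyOnE g s ξ ≤ (convexifyOn g s ξ : EReal) :=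
    iSup_le fun p => iSup_le fun c => iSup_le fun hpc =>
      EReal.coe_le_coe_iff.2 (inner_add_le_convexifyOn hξ hpc)
  refine le_antisymm hub ?_
  have hbot : convexifyOnE g s ξ ≠ ⊥ :=
    ((EReal.bot_lt_coe _).trans_le (hle 0 M fun ζ hζ => by simpa using hM ζ hζ)).ne'
  have htop : convexifyOnE g s ξ ≠ ⊤ := (hub.trans_lt (EReal.coe_lt_top _)).ne
  rw [← EReal.coe_toReal htop hbot]
  refine EReal.coe_le_coe_iff.2 (convexifyOn_le hM fun p c hpc => ?_)
  rw [← EReal.coe_le_coe_iff, EReal.coe_toReal htop hbot]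
  exact hle p c hpc

lemma convexOn_convexifyOn {M : ℝ} (hM : ∀ ζ ∈ s, M ≤ g ζ) (hs : Convex ℝ s) :
    ConvexOn ℝ s (convexifyOn g s) := by
  refine ⟨hs, fun x hx y hy a b ha hb hab => convexifyOn_le hM fun p c hpc => ?_⟩
  have hx' := mul_le_mul_of_nonneg_left (inner_add_le_convexifyOn hx hpc) ha
  have hy' := mul_le_mul_of_nonneg_left (inner_add_le_convexifyOn hy hpc) hb
  have hc : c = a * c + b * c := by rw [← add_mul, hab, one_mul]
  rw [inner_add_right, inner_smul_right, inner_smul_right, smul_eq_mul, smul_eq_mul]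
  linarith

/-- The bipolar is nonexpansive for the sup distance. -/
lemma convexifyOn_le_add {M ε : ℝ} (hM : ∀ ζ ∈ s, M ≤ g ζ) (hgh : ∀ ζ ∈ s, g ζ ≤ h ζ + ε)
    (hξ : ξ ∈ s) : convexifyOn g s ξ ≤ convexifyOn h s ξ + ε := by
  refine convexifyOn_le hM fun p c hpc => ?_
  have := inner_add_le_convexifyOn (g := h) (c := c - ε) hξ
    fun ζ hζ => by linarith [hpc ζ hζ, hgh ζ hζ]
  linarith

end BipolarContinuity

/-- Joint continuity follows from continuity in the first variable, locally uniform in the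
second one; convexity takes care of the second variable. -/
lemma continuousOn_convexifyOnE {N : ℕ} {f : ℝ → Euc N → ℝ} (hf : Hyp5 f) (K : ℝ) :
    ContinuousOn (fun q : ℝ × Euc N => convexifyOnE (f q.1) (closedBall (0 : Euc N) K) q.2)
      (Set.univ ×ˢ ball (0 : Euc N) K) := by
  obtain ⟨-, hcont, hbdd⟩ := hf
  have hbelow : ∀ u, ∃ M : ℝ, ∀ ζ ∈ closedBall (0 : Euc N) K, M ≤ f u ζ := fun u => by
    obtain ⟨M, hM⟩ := hbdd u _ isBounded_closedBall
    exact ⟨-M, fun ζ hζ => (abs_le.1 (hM ζ hζ)).1⟩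
  choose M hM using hbelow
  have hreal : ContinuousOn
      (fun q : ℝ × Euc N => convexifyOn (f q.1) (closedBall (0 : Euc N) K) q.2)
      (Set.univ ×ˢ ball (0 : Euc N) K) := by
    rintro ⟨u₀, ξ₀⟩ ⟨-, hξ₀⟩
    rw [Metric.continuousWithinAt_iff]
    intro ε hε
    have hconv : ContinuousOn (convexifyOn (f u₀) (closedBall (0 : Euc N) K)) (ball 0 K) :=
      ((convexOn_convexifyOn (hM u₀) (convex_closedBall 0 K)).subset ball_subset_closedBall
        (convex_ball 0 K)).continuousOn isOpen_ball
    obtain ⟨δ₁, hδ₁, h₁⟩ := Metric.continuousWithinAt_iff.1 (hconv ξ₀ hξ₀) (ε / 2) (half_pos hε)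
    obtain ⟨δ₂, hδ₂, h₂⟩ := hcont u₀ (closedBall 0 K) isBounded_closedBall (ε / 2) (half_pos hε)
    refine ⟨min δ₁ δ₂, lt_min hδ₁ hδ₂, ?_⟩
    rintro ⟨u, ξ⟩ ⟨-, hξ⟩ hdist
    rw [Prod.dist_eq, max_lt_iff] at hdist
    have hu := h₂ u (hdist.1.trans_le (min_le_right _ _))
    have hle := convexifyOn_le_add (h := f u₀) (ε := ε / 2) (hM u)
      (fun ζ hζ => by linarith [(abs_lt.1 (hu ζ hζ)).2]) (ball_subset_closedBall hξ)
    have hge := convexifyOn_le_add (h := f u) (ε := ε / 2) (hM u₀)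
      (fun ζ hζ => by linarith [(abs_lt.1 (hu ζ hζ)).1]) (ball_subset_closedBall hξ)
    have hd := h₁ hξ (hdist.2.trans_le (min_le_left _ _))
    rw [Real.dist_eq, abs_lt] at hd ⊢
    constructor <;> dsimp only <;> linarith [hd.1, hd.2]
  exact (continuous_coe_real_ereal.comp_continuousOn hreal).congr fun q hq =>
    convexifyOnE_eq_coe (hM q.1) (ball_subset_closedBall hq.2)

/-- If `f` is continuous in `u`, then `f**` is Borel: its strict superlevel sets are countable
unions of projections, along compact sets of affine functions, of closed sets. -/
lemma measurable_convexifyOnE {N : ℕ} {f : ℝ → Euc N → ℝ} (hf : ∀ ζ, Continuous fun u => f u ζ)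
    (s : Set (Euc N)) : Measurable (fun q : ℝ × Euc N => convexifyOnE (f q.1) s q.2) := by
  let C : ℝ → ℕ → Set (ℝ × Euc N) := fun b n => {q | ∃ r ∈ closedBall (0 : Euc N × ℝ) n,
    (∀ ζ ∈ s, ⟪r.1, ζ⟫ + r.2 ≤ f q.1 ζ) ∧ b ≤ ⟪r.1, q.2⟫ + r.2}
  have hC : ∀ b n, IsClosed (C b n) := fun b n => by
    have hcl : IsClosed {x : closedBall (0 : Euc N × ℝ) n × (ℝ × Euc N) |
        (∀ ζ ∈ s, ⟪x.1.1.1, ζ⟫ + x.1.1.2 ≤ f x.2.1 ζ) ∧ b ≤ ⟪x.1.1.1, x.2.2⟫ + x.1.1.2} := by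
      simp only [Set.ofPred_and, Set.ofPred_forall]
      exact (isClosed_iInter fun ζ => isClosed_iInter fun _ =>
        isClosed_le (by fun_prop) ((hf ζ).comp (by fun_prop))).inter
        (isClosed_le (by fun_prop) (by fun_prop))
    have : CompactSpace (closedBall (0 : Euc N × ℝ) n) :=
      isCompact_iff_compactSpace.1 (isCompact_closedBall _ _)
    convert isClosedMap_snd_of_compactSpace _ hcl using 1
    ext q
    simp [C, and_left_comm]
  refine measurable_of_Ioi fun a => ?_
  have hset : (fun q : ℝ × Euc N => convexifyOnE (f q.1) s q.2) ⁻¹' Ioi a =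
      ⋃ (b : ℚ) (_ : a < ((b : ℝ) : EReal)) (n : ℕ), C b n := by
    ext ⟨u, ξ⟩
    simp only [mem_preimage, mem_Ioi, mem_iUnion, convexifyOnE, lt_iSup_iff, C, mem_ofPred_eq]
    constructor
    · rintro ⟨p, c, hpc, ha⟩
      obtain ⟨b, hab, hb⟩ := EReal.lt_iff_exists_rat_btwn.1 ha
      obtain ⟨n, hn⟩ := exists_nat_ge ‖((p, c) : Euc N × ℝ)‖
      exact ⟨b, hab, n, (p, c), mem_closedBall_zero_iff.2 hn, hpc,
        (EReal.coe_lt_coe_iff.1 hb).le⟩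
    · rintro ⟨b, hab, n, ⟨p, c⟩, -, hpc, hb⟩
      exact ⟨p, c, hpc, hab.trans_le (EReal.coe_le_coe_iff.2 hb)⟩
  rw [hset]
  exact MeasurableSet.iUnion fun b => MeasurableSet.iUnion fun _ =>
    MeasurableSet.iUnion fun n => (hC b n).measurableSet

lemma Hyp5.continuous_left {N : ℕ} {f : ℝ → Euc N → ℝ} (hf : Hyp5 f) (ζ : Euc N) :
    Continuous fun u => f u ζ := by
  refine Metric.continuous_iff.2 fun u₀ ε hε => ?_
  obtain ⟨δ, hδ, h⟩ := hf.2.1 u₀ {ζ} Bornology.isBounded_singleton ε hε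
  exact ⟨δ, hδ, fun u hu => h u hu ζ rfl⟩

/-- Lemma 5.7: under Hypothesis 5, for every `K ∈ ℕ` the bipolar
`(f_K)**` of the truncation `f_K` (equal to `+∞` for `‖ξ‖ > K`) is jointly continuous on
`ℝ × B_K(0)`; furthermore `f**` is a Borel function on `ℝ × ℝ^N`. -/
theorem truncated_bipolar_continuous_and_borel
    {N : ℕ} (f : ℝ → Euc N → ℝ) (hf : Hyp5 f) :
    (∀ K : ℕ, ContinuousOn
        (fun q : ℝ × Euc N => convexifyOnE (f q.1) (closedBall (0 : Euc N) (K : ℝ)) q.2)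
        (Set.univ ×ˢ ball (0 : Euc N) (K : ℝ))) ∧
    Measurable (fun q : ℝ × Euc N => convexifyOnE (f q.1) Set.univ q.2) := by
  exact ⟨fun K => continuousOn_convexifyOnE hf K,
    measurable_convexifyOnE hf.continuous_left Set.univ⟩
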